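/- Let δ > 0, s ∈ ℝ, t < 0, and 1 ≤ p, r ≤ ∞, and let ω = (ω_k)_{k ≥ −1} ∈ AF(δ). There exists a constant C > 0, depending only on δ, s, t, p, r and the cutoff pair (χ, φ) but not on ω, such that for all complex-valued Schwartz functions f, g on ℝ³ one has ∥T_f g∥_{B^s_{p,r}(ω)} ≤ C ∥f∥_{B^t_{∞,∞}} ∥∇g∥_{B^{s−t−1}_{p,r}(ω)}, where ∥∇g∥_{B^{s−t−1}_{p,r}(ω)} denotes the ℓ^r norm over k ≥ −1 of (ω_k 2^{k(s−t−1)} (Σ_{j=1}^3 ∥Δ_k ∂_j g∥_{L^p}²)^{1/2}). -/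

import Mathlib

open MeasureTheory SchwartzMap Real
open scoped FourierTransform ENNReal NNReal

noncomputable section

/-- `ℝ³` as a Euclidean space. -/
abbrev E3 : Type := EuclideanSpace ℝ (Fin 3)

/-- A Littlewood–Paley cutoff pair `(χ, φ)`: smooth functions with
`supp χ ⊆ {|ξ| ≤ 4/3}`, `supp φ ⊆ {3/4 ≤ |ξ| ≤ 8/3}` and
`χ(ξ) + Σ_{k ≥ 0} φ(2^{-k} ξ) = 1` for all `ξ`. -/
structure LPCutoff where
  χ : E3 → ℝ
  φ : E3 → ℝ
  smooth_χ : ContDiff ℝ (⊤ : ℕ∞) χ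
  smooth_φ : ContDiff ℝ (⊤ : ℕ∞) φ
  supp_χ : ∀ ξ : E3, 4 / 3 < ‖ξ‖ → χ ξ = 0
  supp_φ : ∀ ξ : E3, ‖ξ‖ < 3 / 4 ∨ 8 / 3 < ‖ξ‖ → φ ξ = 0
  partition : ∀ ξ : E3, χ ξ + ∑' k : ℕ, φ ((2 : ℝ) ^ (-(k : ℤ)) • ξ) = 1

/-- The Littlewood–Paley block `Δ_k f`, indexed by `n : ℕ` corresponding to `k = n - 1 ≥ -1`
(blocks with `k ≤ -2` vanish):
`Δ_{-1} f = 𝓕⁻¹(χ 𝓕f)` and `Δ_k f = 𝓕⁻¹(φ(2^{-k}·) 𝓕f)` for `k ≥ 0`. -/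
def LPblock (P : LPCutoff) (n : ℕ) (f : E3 → ℂ) : E3 → ℂ :=
  if n = 0 then 𝓕⁻ (fun ξ => (P.χ ξ : ℂ) * 𝓕 f ξ)
  else 𝓕⁻ (fun ξ => (P.φ ((2 : ℝ) ^ (-((n : ℤ) - 1)) • ξ) : ℂ) * 𝓕 f ξ)

/-- `LPlow P j f = Σ_{n < j} Δ^{(n)} f`, i.e. the low-frequency cutoff `S_{j-1} f`
in the paper's indexing (so `S_j f = LPlow P (j+1) f`). -/
def LPlow (P : LPCutoff) (j : ℕ) (f : E3 → ℂ) : E3 → ℂ :=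
  fun x => ∑ n ∈ Finset.range j, LPblock P n f x

/-- Bony's paraproduct `T_f g = Σ_l S_{l-1} f · Δ_l g` (the terms with `l ≤ 0` vanish). -/
def paraproduct (P : LPCutoff) (f g : E3 → ℂ) : E3 → ℂ :=
  fun x => ∑' l : ℕ, LPlow P (l + 1) f x * LPblock P (l + 2) g x

/-- Bony's remainder `R(f,g) = Σ_l Δ_l f · (Δ_{l-1} + Δ_l + Δ_{l+1}) g`
(the terms with `l ≤ -2` vanish). -/
def lpRemainder (P : LPCutoff) (f g : E3 → ℂ) : E3 → ℂ :=
  fun x => ∑' n : ℕ, LPblock P n f x *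
    ((if n = 0 then 0 else LPblock P (n - 1) g x) +
      LPblock P n g x + LPblock P (n + 1) g x)

/-- The weighted Besov norm `∥f∥_{B^s_{p,r}(ω)}`: the `ℓ^r` norm (over `k = n - 1 ≥ -1`)
of `(ω_k 2^{ks} ∥Δ_k f∥_{L^p})`. -/
def besovW (P : LPCutoff) (ω : ℕ → ℝ) (s : ℝ) (p r : ℝ≥0∞) (f : E3 → ℂ) : ℝ≥0∞ :=
  eLpNorm (fun n : ℕ =>
    ω n * (2 : ℝ) ^ (((n : ℝ) - 1) * s) * (eLpNorm (LPblock P n f) p volume).toReal)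
    r (Measure.count : Measure ℕ)

/-- The (unweighted) Besov norm `∥f∥_{B^s_{p,r}}`. -/
def besov (P : LPCutoff) (s : ℝ) (p r : ℝ≥0∞) (f : E3 → ℂ) : ℝ≥0∞ :=
  besovW P (fun _ => 1) s p r f

/-- The `j`-th partial derivative of a complex-valued function on `ℝ³`. -/
def pdC (j : Fin 3) (f : E3 → ℂ) : E3 → ℂ :=
  fun x => fderiv ℝ f x (EuclideanSpace.single j 1)

/-- The weighted Besov norm of a gradient, `∥∇g∥_{B^s_{p,r}(ω)}`: the `ℓ^r` norm over
`k = n - 1 ≥ -1` of `(ω_k 2^{ks} (Σ_j ∥Δ_k ∂_j g∥_{L^p}²)^{1/2})`. -/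
def gradBesovW (P : LPCutoff) (ω : ℕ → ℝ) (s : ℝ) (p r : ℝ≥0∞) (g : E3 → ℂ) : ℝ≥0∞ :=
  eLpNorm (fun n : ℕ =>
    ω n * (2 : ℝ) ^ (((n : ℝ) - 1) * s) *
      (∑ j : Fin 3, ((eLpNorm (LPblock P n (pdC j g)) p volume).toReal) ^ 2) ^ ((1 : ℝ) / 2))
    r (Measure.count : Measure ℕ)

/-- An acceptable frequency weight of parameter `δ`:
`1 ≤ ω_k ≤ ω_{k+1} ≤ 2^δ ω_k` for all `k ≥ -1`. -/
def AFweight (δ : ℝ) (ω : ℕ → ℝ) : Prop :=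
  ∀ k : ℕ, 1 ≤ ω k ∧ ω k ≤ ω (k + 1) ∧ ω (k + 1) ≤ (2 : ℝ) ^ δ * ω k

open scoped Convolution LineDeriv

section Young

variable {G : Type*} [MeasurableSpace G] [AddCommGroup G] [MeasurableAdd₂ G] [MeasurableNeg G]
  {μ : Measure G} [SFinite μ] [μ.IsAddLeftInvariant]

/-- Jensen's inequality for a convolution with a nonnegative kernel. -/
theorem lintegral_mul_rpow_le_of_one_le {α : Type*} [MeasurableSpace α] {ν : Measure α}
    {k v : α → ℝ≥0∞} (hk : Measurable k) (hv : Measurable v) {q : ℝ} (hq : 1 ≤ q) :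
    (∫⁻ y, k y * v y ∂ν) ^ q ≤ (∫⁻ y, k y ∂ν) ^ (q - 1) * ∫⁻ y, k y * v y ^ q ∂ν := by
  have hq0 : 0 < q := by linarith
  have h := eLpNorm_le_eLpNorm_mul_rpow_measure_univ (μ := ν.withDensity k) (f := v) (p := 1)
    (q := ENNReal.ofReal q) (by simpa using ENNReal.ofReal_le_ofReal hq) hv.aestronglyMeasurable
  rw [eLpNorm_one_eq_lintegral_enorm, eLpNorm_eq_lintegral_rpow_enorm_toReal
    (by simpa using hq0) (by simp), ENNReal.toReal_ofReal hq0.le] at h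
  simp only [enorm_eq_self] at h
  rw [lintegral_withDensity_eq_lintegral_mul _ hk hv,
    lintegral_withDensity_eq_lintegral_mul _ hk (hv.pow_const q),
    withDensity_apply _ MeasurableSet.univ, Measure.restrict_univ] at h
  simp only [Pi.mul_apply] at h
  calc (∫⁻ y, k y * v y ∂ν) ^ q
      ≤ ((∫⁻ y, k y * v y ^ q ∂ν) ^ (1 / q) *
          (∫⁻ y, k y ∂ν) ^ (1 / (1 : ℝ≥0∞).toReal - 1 / q)) ^ q := by gcongr
    _ = _ := by
      rw [ENNReal.mul_rpow_of_nonneg _ _ hq0.le, ← ENNReal.rpow_mul, ← ENNReal.rpow_mul, mul_comm]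
      congr 2
      · simp; field_simp
      · rw [one_div_mul_cancel hq0.ne', ENNReal.rpow_one]

/-- Young's inequality `L¹ * L^p ⊆ L^p`. -/
theorem eLpNorm_convolution_mul_le {K h : G → ℂ} (hK : Measurable K) (hh : Measurable h)
    {p : ℝ≥0∞} (hp : 1 ≤ p) :
    eLpNorm (K ⋆[ContinuousLinearMap.mul ℂ ℂ, μ] h) p μ ≤ eLpNorm K 1 μ * eLpNorm h p μ := by
  have hpt : ∀ x, ‖(K ⋆[ContinuousLinearMap.mul ℂ ℂ, μ] h) x‖ₑ ≤
      ∫⁻ y, ‖K y‖ₑ * ‖h (x - y)‖ₑ ∂μ := by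
    intro x
    refine (enorm_integral_le_lintegral_enorm _).trans_eq ?_
    simp
  rcases eq_or_ne p ∞ with rfl | hp'
  · rw [eLpNorm_exponent_top, eLpNorm_exponent_top, eLpNorm_one_eq_lintegral_enorm]
    refine essSup_le_of_ae_le _ (Filter.Eventually.of_forall fun x => (hpt x).trans ?_)
    rw [← lintegral_mul_const _ hK.enorm]
    refine lintegral_mono_ae ?_
    have hae : ∀ᵐ y ∂μ, ‖h (x - y)‖ₑ ≤ eLpNormEssSup h μ :=
      (quasiMeasurePreserving_sub_left μ x).ae ae_le_eLpNormEssSup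
    filter_upwards [hae] with y hy
    gcongr
  · have hp0 : p ≠ 0 := by positivity
    set q := p.toReal with hq
    have hq1 : 1 ≤ q := by
      rw [hq, ← ENNReal.toReal_one]; exact ENNReal.toReal_mono hp' hp
    have hq0 : 0 < q := by linarith
    rw [eLpNorm_eq_lintegral_rpow_enorm_toReal hp0 hp',
      eLpNorm_eq_lintegral_rpow_enorm_toReal hp0 hp', eLpNorm_one_eq_lintegral_enorm, ← hq]
    set A := ∫⁻ y, ‖K y‖ₑ ∂μ
    set B := ∫⁻ y, ‖h y‖ₑ ^ q ∂μ
    have hm : Measurable (fun z : G × G => ‖K z.2‖ₑ * ‖h (z.1 - z.2)‖ₑ ^ q) := by fun_prop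
    have key : ∫⁻ x, ‖(K ⋆[ContinuousLinearMap.mul ℂ ℂ, μ] h) x‖ₑ ^ q ∂μ ≤ A ^ q * B := by
      calc _ ≤ ∫⁻ x, A ^ (q - 1) * ∫⁻ y, ‖K y‖ₑ * ‖h (x - y)‖ₑ ^ q ∂μ ∂μ := by
            refine lintegral_mono fun x => ?_
            refine (ENNReal.rpow_le_rpow (hpt x) hq0.le).trans ?_
            exact lintegral_mul_rpow_le_of_one_le hK.enorm (by fun_prop) hq1
        _ = A ^ (q - 1) * ∫⁻ x, ∫⁻ y, ‖K y‖ₑ * ‖h (x - y)‖ₑ ^ q ∂μ ∂μ :=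
            lintegral_const_mul _ hm.lintegral_prod_right'
        _ = A ^ (q - 1) * ∫⁻ y, ∫⁻ x, ‖K y‖ₑ * ‖h (x - y)‖ₑ ^ q ∂μ ∂μ := by
            rw [lintegral_lintegral_swap hm.aemeasurable]
        _ = A ^ (q - 1) * (A * B) := by
            congr 1
            rw [← lintegral_mul_const _ hK.enorm]
            refine lintegral_congr fun y => ?_
            rw [lintegral_const_mul _ (by fun_prop),
              lintegral_sub_right_eq_self (fun x => ‖h x‖ₑ ^ q) y]
        _ = A ^ q * B := by
            rw [← mul_assoc]
            congr 1
            conv_rhs => rw [← sub_add_cancel q 1,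
              ENNReal.rpow_add_of_nonneg _ _ (by linarith) zero_le_one, ENNReal.rpow_one]
    calc _ ≤ (A ^ q * B) ^ (1 / q) := by gcongr
      _ = A * B ^ (1 / q) := by
        rw [ENNReal.mul_rpow_of_nonneg _ _ (by positivity), ← ENNReal.rpow_mul,
          mul_one_div_cancel hq0.ne', ENNReal.rpow_one]

end Young

section Multiplier

/-- The Fourier multiplier with Schwartz symbol `ψ`, acting on Schwartz functions. -/
def schwartzMultiplier (ψ h : 𝓢(E3, ℂ)) : 𝓢(E3, ℂ) :=
  SchwartzMap.convolution (ContinuousLinearMap.mul ℂ ℂ) (𝓕⁻ ψ) h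

theorem fourier_schwartzMultiplier_apply (ψ h : 𝓢(E3, ℂ)) (ξ : E3) :
    𝓕 (schwartzMultiplier ψ h) ξ = ψ ξ * 𝓕 h ξ := by
  simp [schwartzMultiplier, SchwartzMap.fourier_convolution]

theorem coe_schwartzMultiplier (ψ h : 𝓢(E3, ℂ)) :
    ⇑(schwartzMultiplier ψ h) = 𝓕⁻ (fun ξ => ψ ξ * 𝓕 (⇑h) ξ) := by
  have : (fun ξ => ψ ξ * 𝓕 (⇑h) ξ) = ⇑(𝓕 (schwartzMultiplier ψ h) : 𝓢(E3, ℂ)) := by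
    ext ξ
    rw [fourier_schwartzMultiplier_apply, SchwartzMap.fourier_coe]
  rw [this, ← SchwartzMap.fourierInv_coe, FourierTransform.fourierInv_fourier_eq]

theorem schwartz_ext_fourier {u v : 𝓢(E3, ℂ)} (h : ∀ ξ, 𝓕 u ξ = 𝓕 v ξ) : u = v := by
  have : (𝓕 u : 𝓢(E3, ℂ)) = 𝓕 v := by ext ξ; exact h ξ
  rw [← FourierTransform.fourierInv_fourier_eq (F := 𝓢(E3, ℂ)) u, this,
    FourierTransform.fourierInv_fourier_eq]

theorem eLpNorm_schwartzMultiplier_le (ψ h : 𝓢(E3, ℂ)) {p : ℝ≥0∞} (hp : 1 ≤ p) :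
    eLpNorm (schwartzMultiplier ψ h) p volume ≤
      eLpNorm ⇑(𝓕⁻ ψ : 𝓢(E3, ℂ)) 1 volume * eLpNorm h p volume := by
  have : ⇑(schwartzMultiplier ψ h) =
      ⇑(𝓕⁻ ψ : 𝓢(E3, ℂ)) ⋆[ContinuousLinearMap.mul ℂ ℂ, volume] ⇑h := by
    ext x
    exact SchwartzMap.convolution_apply _ _ _ x
  rw [this]
  exact eLpNorm_convolution_mul_le (𝓕⁻ ψ : 𝓢(E3, ℂ)).continuous.measurable
    h.continuous.measurable hp

/-- The dilated Schwartz function `ξ ↦ ψ (a ξ)`. -/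
def schwartzDilate (a : ℝˣ) (ψ : 𝓢(E3, ℂ)) : 𝓢(E3, ℂ) :=
  SchwartzMap.compCLMOfContinuousLinearEquiv ℂ
    (ContinuousLinearEquiv.smulLeft (R₁ := ℝ) (M₁ := E3) a) ψ

@[simp]
theorem schwartzDilate_apply (a : ℝˣ) (ψ : 𝓢(E3, ℂ)) (ξ : E3) :
    schwartzDilate a ψ ξ = ψ ((a : ℝ) • ξ) := by
  simp [schwartzDilate, Units.smul_def]

theorem fourierInv_schwartzDilate_apply (a : ℝˣ) (ψ : 𝓢(E3, ℂ)) (x : E3) :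
    𝓕⁻ (schwartzDilate a ψ) x = |((a : ℝ) ^ 3)⁻¹| • 𝓕⁻ ψ ((a : ℝ)⁻¹ • x) := by
  have ha : (a : ℝ) ≠ 0 := a.ne_zero
  rw [SchwartzMap.fourierInv_coe, SchwartzMap.fourierInv_coe, Real.fourierInv_eq,
    Real.fourierInv_eq]
  have := Measure.integral_comp_smul (volume : Measure E3)
    (fun v : E3 => 𝐞 (inner ℝ v ((a : ℝ)⁻¹ • x)) • ψ v) (a : ℝ)
  rw [show Module.finrank ℝ E3 = 3 by simp] at this
  rw [← this]
  refine integral_congr_ae (Filter.Eventually.of_forall fun v => ?_)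
  simp only [schwartzDilate_apply, inner_smul_left, inner_smul_right]
  congr 3
  simp [ha]

theorem eLpNorm_one_fourierInv_schwartzDilate (a : ℝˣ) (ψ : 𝓢(E3, ℂ)) :
    eLpNorm (⇑(𝓕⁻ (schwartzDilate a ψ) : 𝓢(E3, ℂ))) 1 volume =
      eLpNorm ⇑(𝓕⁻ ψ : 𝓢(E3, ℂ)) 1 volume := by
  have ha : (a : ℝ) ≠ 0 := a.ne_zero
  have key : ∀ h : 𝓢(E3, ℂ), eLpNorm h 1 volume = ENNReal.ofReal (∫ x, ‖h x‖) := fun h => by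
    rw [eLpNorm_one_eq_lintegral_enorm, ofReal_integral_norm_eq_lintegral_enorm h.integrable]
  rw [key, key]
  congr 1
  simp_rw [fourierInv_schwartzDilate_apply, norm_smul]
  rw [integral_const_mul, Measure.integral_comp_smul volume (fun x => ‖𝓕⁻ ψ x‖)]
  rw [show Module.finrank ℝ E3 = 3 by simp, smul_eq_mul, ← mul_assoc]
  convert one_mul _
  rw [Real.norm_eq_abs, abs_abs, ← abs_mul]
  simp [ha]

/-- The real-valued `L^p` norm of a Schwartz function. -/
def lpNormS (p : ℝ≥0∞) (h : 𝓢(E3, ℂ)) : ℝ := (eLpNorm h p volume).toReal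

theorem eLpNorm_schwartz_ne_top (p : ℝ≥0∞) (h : 𝓢(E3, ℂ)) :
    eLpNorm (h : E3 → ℂ) p volume ≠ ⊤ :=
  (h.memLp p volume).eLpNorm_ne_top

theorem lpNormS_nonneg (p : ℝ≥0∞) (h : 𝓢(E3, ℂ)) : 0 ≤ lpNormS p h := ENNReal.toReal_nonneg

theorem lpNormS_sum_le {ι : Type*} (s : Finset ι) (u : ι → 𝓢(E3, ℂ)) {p : ℝ≥0∞} (hp : 1 ≤ p) :
    lpNormS p (∑ i ∈ s, u i) ≤ ∑ i ∈ s, lpNormS p (u i) := by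
  have h := eLpNorm_sum_le (μ := (volume : Measure E3)) (s := s) (f := fun i => ⇑(u i))
    (fun i _ => (u i).continuous.aestronglyMeasurable) hp
  have h2 : ⇑(∑ i ∈ s, u i) = ∑ i ∈ s, ⇑(u i) := by
    ext x; simp
  unfold lpNormS
  rw [h2, ← ENNReal.toReal_sum fun i _ => (eLpNorm_schwartz_ne_top p (u i))]
  exact ENNReal.toReal_mono (ENNReal.sum_ne_top.2 fun i _ => (eLpNorm_schwartz_ne_top p (u i))) h

theorem lpNormS_multiplier_dilate_le (a : ℝˣ) (ψ h : 𝓢(E3, ℂ)) {p : ℝ≥0∞} (hp : 1 ≤ p) :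
    lpNormS p (schwartzMultiplier (schwartzDilate a ψ) h) ≤ lpNormS 1 (𝓕⁻ ψ) * lpNormS p h := by
  have h1 := eLpNorm_schwartzMultiplier_le (schwartzDilate a ψ) h hp
  rw [eLpNorm_one_fourierInv_schwartzDilate] at h1
  unfold lpNormS
  rw [← ENNReal.toReal_mul]
  exact ENNReal.toReal_mono
    (ENNReal.mul_ne_top (eLpNorm_schwartz_ne_top 1 (𝓕⁻ ψ : 𝓢(E3, ℂ)))
      (eLpNorm_schwartz_ne_top p h)) h1

/-- The pointwise product of two Schwartz functions. -/
def schwartzMul (u v : 𝓢(E3, ℂ)) : 𝓢(E3, ℂ) :=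
  SchwartzMap.pairing (ContinuousLinearMap.mul ℂ ℂ) u v

@[simp]
theorem schwartzMul_apply (u v : 𝓢(E3, ℂ)) (x : E3) : schwartzMul u v x = u x * v x := rfl

theorem lpNormS_mul_le (u v : 𝓢(E3, ℂ)) (p : ℝ≥0∞) :
    lpNormS p (schwartzMul u v) ≤ lpNormS ⊤ u * lpNormS p v := by
  have h := eLpNorm_smul_le_eLpNorm_top_mul_eLpNorm (μ := (volume : Measure E3)) p
    (v.continuous.aestronglyMeasurable) ⇑u
  unfold lpNormS
  rw [← ENNReal.toReal_mul]
  exact ENNReal.toReal_mono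
    (ENNReal.mul_ne_top (eLpNorm_schwartz_ne_top ⊤ u) (eLpNorm_schwartz_ne_top p v)) h

theorem fourier_schwartzMul (u v : 𝓢(E3, ℂ)) :
    (𝓕 (schwartzMul u v) : 𝓢(E3, ℂ)) =
      SchwartzMap.convolution (ContinuousLinearMap.mul ℂ ℂ) (𝓕 u) (𝓕 v) := by
  have h : (𝓕⁻ (SchwartzMap.convolution (ContinuousLinearMap.mul ℂ ℂ) (𝓕 u) (𝓕 v)) : 𝓢(E3, ℂ)) =
      schwartzMul u v := by
    ext x
    rw [SchwartzMap.fourierInv_apply_eq, SchwartzMap.fourier_convolution]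
    have hu := congrArg (fun w : 𝓢(E3, ℂ) => w x)
      (FourierTransform.fourierInv_fourier_eq (F := 𝓢(E3, ℂ)) u)
    have hv := congrArg (fun w : 𝓢(E3, ℂ) => w x)
      (FourierTransform.fourierInv_fourier_eq (F := 𝓢(E3, ℂ)) v)
    simp only [SchwartzMap.fourierInv_apply_eq] at hu hv
    simp only [SchwartzMap.compCLMOfContinuousLinearEquiv_apply, Function.comp_apply] at hu hv ⊢
    simp [hu, hv] at *
  rw [← h, FourierTransform.fourier_fourierInv_eq]

/-- The Fourier transform of a product lives on the sum of the frequency supports. -/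
theorem fourier_schwartzMul_eq_zero {u v : 𝓢(E3, ℂ)} {ξ : E3}
    (h : ∀ η, 𝓕 u η = 0 ∨ 𝓕 v (ξ - η) = 0) : 𝓕 (schwartzMul u v) ξ = 0 := by
  rw [fourier_schwartzMul, SchwartzMap.convolution_apply, MeasureTheory.convolution_def]
  refine integral_eq_zero_of_ae (Filter.Eventually.of_forall fun η => ?_)
  rcases h η with h | h <;> simp [h]

end Multiplier

section Blocks

variable (P : LPCutoff)

theorem hasCompactSupport_of_eq_zero_of_lt_norm {ψ : E3 → ℂ} {R : ℝ}
    (h : ∀ ξ, R < ‖ξ‖ → ψ ξ = 0) : HasCompactSupport ψ := by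
  refine HasCompactSupport.of_support_subset_isCompact (isCompact_closedBall (0 : E3) R) ?_
  intro ξ hξ
  by_contra hc
  exact hξ (h ξ (by simpa using hc))

/-- The low-frequency cutoff as a complex Schwartz function. -/
def LPCutoff.chiS : 𝓢(E3, ℂ) :=
  (hasCompactSupport_of_eq_zero_of_lt_norm (ψ := fun ξ => (P.χ ξ : ℂ)) (R := 4 / 3)
    fun ξ hξ => by simp [P.supp_χ ξ hξ]).toSchwartzMap
    (Complex.ofRealCLM.contDiff.comp P.smooth_χ)

/-- The annular cutoff as a complex Schwartz function. -/
def LPCutoff.phiS : 𝓢(E3, ℂ) :=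
  (hasCompactSupport_of_eq_zero_of_lt_norm (ψ := fun ξ => (P.φ ξ : ℂ)) (R := 8 / 3)
    fun ξ hξ => by simp [P.supp_φ ξ (Or.inr hξ)]).toSchwartzMap
    (Complex.ofRealCLM.contDiff.comp P.smooth_φ)

theorem LPCutoff.chiS_apply (ξ : E3) : P.chiS ξ = (P.χ ξ : ℂ) := rfl

theorem LPCutoff.phiS_apply (ξ : E3) : P.phiS ξ = (P.φ ξ : ℂ) := rfl

/-- The scale `2^{-(n-1)}` of the `n`-th Littlewood–Paley block. -/
def dyadicScale (n : ℕ) : ℝˣ := Units.mk0 ((2 : ℝ) ^ (-((n : ℤ) - 1))) (by positivity)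

theorem dyadicScale_val (n : ℕ) : (dyadicScale n : ℝ) = 2 / 2 ^ n := by
  rw [dyadicScale, Units.val_mk0, neg_sub, zpow_sub₀ two_ne_zero]
  simp

/-- The symbol of the `n`-th Littlewood–Paley block. -/
def lpSymbol (n : ℕ) : 𝓢(E3, ℂ) :=
  if n = 0 then P.chiS else schwartzDilate (dyadicScale n) P.phiS

/-- The `n`-th Littlewood–Paley block as an operator on Schwartz functions. -/
def lpBlockS (n : ℕ) (h : 𝓢(E3, ℂ)) : 𝓢(E3, ℂ) := schwartzMultiplier (lpSymbol P n) h

theorem LPblock_eq_fourierInv (n : ℕ) (h : E3 → ℂ) :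
    LPblock P n h = 𝓕⁻ (fun ξ => lpSymbol P n ξ * 𝓕 h ξ) := by
  unfold LPblock lpSymbol
  split_ifs with hn
  · rfl
  · simp only [schwartzDilate_apply, LPCutoff.phiS_apply]
    rfl

theorem LPblock_coe (n : ℕ) (h : 𝓢(E3, ℂ)) : LPblock P n ⇑h = ⇑(lpBlockS P n h) := by
  rw [LPblock_eq_fourierInv, lpBlockS, coe_schwartzMultiplier]

theorem norm_le_of_lpSymbol_ne_zero {n : ℕ} {ξ : E3} (h : lpSymbol P n ξ ≠ 0) :
    ‖ξ‖ ≤ 4 / 3 * 2 ^ n := by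
  by_contra! hc
  apply h
  unfold lpSymbol
  split_ifs with hn
  · subst hn
    simp [LPCutoff.chiS_apply, P.supp_χ ξ (by simpa using hc)]
  · rw [schwartzDilate_apply, LPCutoff.phiS_apply, P.supp_φ _ (Or.inr ?_), Complex.ofReal_zero]
    rw [dyadicScale_val, norm_smul, Real.norm_of_nonneg (by positivity), div_mul_eq_mul_div,
      lt_div_iff₀ (by positivity)]
    linarith

theorem le_norm_of_lpSymbol_ne_zero {n : ℕ} (hn : n ≠ 0) {ξ : E3} (h : lpSymbol P n ξ ≠ 0) :
    3 / 8 * 2 ^ n ≤ ‖ξ‖ := by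
  by_contra! hc
  apply h
  unfold lpSymbol
  rw [if_neg hn, schwartzDilate_apply, LPCutoff.phiS_apply, P.supp_φ _ (Or.inl ?_),
    Complex.ofReal_zero]
  rw [dyadicScale_val, norm_smul, Real.norm_of_nonneg (by positivity), div_mul_eq_mul_div,
    div_lt_iff₀ (by positivity)]
  linarith

/-- The Littlewood–Paley blocks are bounded on `L^p`, uniformly in the frequency and in `p`. -/
theorem exists_lpNormS_lpBlockS_le :
    ∃ A : ℝ, 0 < A ∧ ∀ (n : ℕ) (p : ℝ≥0∞), 1 ≤ p → ∀ h : 𝓢(E3, ℂ),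
      lpNormS p (lpBlockS P n h) ≤ A * lpNormS p h := by
  have h1 := lpNormS_nonneg 1 (𝓕⁻ P.chiS)
  have h2 := lpNormS_nonneg 1 (𝓕⁻ P.phiS)
  refine ⟨lpNormS 1 (𝓕⁻ P.chiS) + lpNormS 1 (𝓕⁻ P.phiS) + 1, by linarith, fun n p hp h => ?_⟩
  have h3 := lpNormS_nonneg p h
  unfold lpBlockS lpSymbol
  split_ifs with hn
  · have h4 := lpNormS_multiplier_dilate_le 1 P.chiS h hp
    have h5 : schwartzDilate 1 P.chiS = P.chiS := by ext ξ; simp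
    rw [h5] at h4
    refine h4.trans (mul_le_mul_of_nonneg_right ?_ h3)
    linarith
  · refine (lpNormS_multiplier_dilate_le _ P.phiS h hp).trans (mul_le_mul_of_nonneg_right ?_ h3)
    linarith

/-- The functions `η_j / (2πi |η|²)`, cut off smoothly away from the annulus carrying `φ`. -/
theorem exists_schwartz_inverse_gradient_symbol :
    ∃ ψ : Fin 3 → 𝓢(E3, ℂ), ∀ η : E3, 3 / 4 ≤ ‖η‖ → ‖η‖ ≤ 8 / 3 →
      ∑ j, ψ j η * (2 * π * Complex.I * (η j : ℂ)) = 1 := by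
  let b₁ : ContDiffBump (0 : E3) := ⟨8 / 3, 3, by norm_num, by norm_num⟩
  let b₀ : ContDiffBump (0 : E3) := ⟨1 / 2, 3 / 4, by norm_num, by norm_num⟩
  let w : Fin 3 → E3 → ℝ := fun j η => b₁ η * (1 - b₀ η) * (η j / ‖η‖ ^ 2)
  have hw : ∀ j, ContDiff ℝ (⊤ : ℕ∞) (w j) := by
    intro j
    rw [contDiff_iff_contDiffAt]
    intro η
    rcases eq_or_ne η 0 with rfl | hη
    · refine (contDiffAt_const (c := (0 : ℝ))).congr_of_eventuallyEq ?_
      filter_upwards [Metric.closedBall_mem_nhds (0 : E3) (show (0 : ℝ) < 1 / 2 by norm_num)]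
        with x hx
      have : b₀ x = 1 := b₀.one_of_mem_closedBall hx
      simp [w, this]
    · have h1 : ContDiffAt ℝ (⊤ : ℕ∞) (fun x : E3 => ‖x‖ ^ 2) η :=
        (contDiff_norm_sq ℝ).contDiffAt
      have h2 : ContDiffAt ℝ (⊤ : ℕ∞) (fun x : E3 => x j) η :=
        (EuclideanSpace.proj (𝕜 := ℝ) j).contDiff.contDiffAt
      exact (b₁.contDiff.contDiffAt.mul (contDiffAt_const.sub b₀.contDiff.contDiffAt)).mul
        (h2.div h1 (by simpa using hη))
  have hc : ∀ j, HasCompactSupport (fun η => (w j η : ℂ) * (2 * π * Complex.I)⁻¹) := fun j =>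
    hasCompactSupport_of_eq_zero_of_lt_norm (R := 3) fun ξ hξ => by
      have : b₁ ξ = 0 := b₁.zero_of_le_dist (by simpa using hξ.le)
      simp [w, this]
  refine ⟨fun j => (hc j).toSchwartzMap
    ((Complex.ofRealCLM.contDiff.comp (hw j)).mul contDiff_const), fun η h1 h2 => ?_⟩
  have e1 : b₁ η = 1 := b₁.one_of_mem_closedBall (by simpa using h2)
  have e0 : b₀ η = 0 := b₀.zero_of_le_dist (by simpa using h1)
  have hη : ‖η‖ ^ 2 ≠ 0 := by positivity
  have hsum : ∑ j, η j ^ 2 = ‖η‖ ^ 2 := by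
    simp [EuclideanSpace.norm_sq_eq]
  have hpi : (2 * π * Complex.I : ℂ) ≠ 0 := by simp [Real.pi_ne_zero]
  calc _ = ∑ j, (((η j ^ 2) / ‖η‖ ^ 2 : ℝ) : ℂ) := by
        refine Finset.sum_congr rfl fun j _ => ?_
        change (w j η : ℂ) * (2 * π * Complex.I)⁻¹ * _ = _
        simp only [w, e1, e0]
        push_cast
        field_simp
        ring
    _ = 1 := by
        rw [← Complex.ofReal_sum, ← Finset.sum_div, hsum, div_self hη, Complex.ofReal_one]

theorem pdC_coe (j : Fin 3) (g : 𝓢(E3, ℂ)) :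
    pdC j ⇑g = ⇑(∂_{(EuclideanSpace.single j 1 : E3)} g : 𝓢(E3, ℂ)) := by
  ext x
  rw [SchwartzMap.lineDerivOp_apply_eq_fderiv]
  rfl

/-- Bernstein's inequality: high-frequency blocks are controlled by those of the gradient. -/
theorem exists_lpNormS_lpBlockS_le_gradient :
    ∃ B : ℝ, 0 < B ∧ ∀ (n : ℕ), n ≠ 0 → ∀ p : ℝ≥0∞, 1 ≤ p → ∀ g : 𝓢(E3, ℂ),
      lpNormS p (lpBlockS P n g) ≤ B / 2 ^ n *
        ∑ j, lpNormS p (lpBlockS P n (∂_{(EuclideanSpace.single j 1 : E3)} g)) := by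
  obtain ⟨ψ, hψ⟩ := exists_schwartz_inverse_gradient_symbol
  have hB : ∀ j, 0 ≤ lpNormS 1 (𝓕⁻ (ψ j)) := fun j => lpNormS_nonneg _ _
  have hBs : 0 ≤ ∑ j, lpNormS 1 (𝓕⁻ (ψ j)) := Finset.sum_nonneg fun j _ => hB j
  refine ⟨2 * (∑ j, lpNormS 1 (𝓕⁻ (ψ j)) + 1), by linarith, fun n hn p hp g => ?_⟩
  set a := dyadicScale n
  set D : Fin 3 → 𝓢(E3, ℂ) := fun j => lpBlockS P n (∂_{(EuclideanSpace.single j 1 : E3)} g)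
  have key : lpBlockS P n g =
      ((a : ℝ) : ℂ) • ∑ j, schwartzMultiplier (schwartzDilate a (ψ j)) (D j) := by
    refine schwartz_ext_fourier fun ξ => ?_
    have e1 : (𝓕 (((a : ℝ) : ℂ) • ∑ j, schwartzMultiplier (schwartzDilate a (ψ j)) (D j)) :
        𝓢(E3, ℂ)) ξ = ((a : ℝ) : ℂ) * ∑ j, ψ j ((a : ℝ) • ξ) *
          (lpSymbol P n ξ * ((2 * π * Complex.I) * ((ξ j : ℂ) * 𝓕 g ξ))) := by
      rw [FourierTransform.fourier_smul, FourierTransform.fourier_sum]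
      simp only [smul_apply, smul_eq_mul, sum_apply,
        fourier_schwartzMultiplier_apply, schwartzDilate_apply, D, lpBlockS]
      congr 1
      refine Finset.sum_congr rfl fun j _ => ?_
      rw [SchwartzMap.fourier_lineDerivOp_eq]
      have : (fun x : E3 => inner ℝ x (EuclideanSpace.single j (1 : ℝ))).HasTemperateGrowth := by
        fun_prop
      rw [smul_apply, SchwartzMap.smulLeftCLM_apply_apply this]
      simp [EuclideanSpace.inner_single_right]
    rw [e1, lpBlockS, fourier_schwartzMultiplier_apply]
    by_cases h0 : lpSymbol P n ξ = 0
    · simp [h0]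
    · have ha : (a : ℝ) = 2 / 2 ^ n := dyadicScale_val n
      have hnorm : ‖(a : ℝ) • ξ‖ = 2 / 2 ^ n * ‖ξ‖ := by
        rw [ha, norm_smul, Real.norm_of_nonneg (by positivity)]
      have hl := le_norm_of_lpSymbol_ne_zero P hn h0
      have hu := norm_le_of_lpSymbol_ne_zero P h0
      have := hψ ((a : ℝ) • ξ)
        (by rw [hnorm, div_mul_eq_mul_div, le_div_iff₀ (by positivity)]; linarith)
        (by rw [hnorm, div_mul_eq_mul_div, div_le_iff₀ (by positivity)]; linarith)
      rw [Finset.mul_sum]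
      calc _ = (∑ j, ψ j ((a : ℝ) • ξ) * (2 * π * Complex.I * ((((a : ℝ) • ξ) j : ℝ) : ℂ))) *
            (lpSymbol P n ξ * 𝓕 g ξ) := by rw [this, one_mul]
        _ = _ := by
          rw [Finset.sum_mul]
          refine Finset.sum_congr rfl fun j _ => ?_
          simp only [PiLp.smul_apply, smul_eq_mul]
          push_cast
          ring
  have hsmul : ∀ (c : ℂ) (h : 𝓢(E3, ℂ)), lpNormS p (c • h) = ‖c‖ * lpNormS p h := by
    intro c h
    have : ⇑(c • h) = c • ⇑h := rfl
    rw [lpNormS, this, eLpNorm_const_smul, ENNReal.toReal_mul, toReal_enorm, lpNormS]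
  have hD : ∀ j, 0 ≤ lpNormS p (D j) := fun j => lpNormS_nonneg _ _
  rw [key, hsmul, Complex.norm_real, Real.norm_eq_abs, dyadicScale_val,
    abs_of_nonneg (by positivity)]
  calc _ ≤ 2 / 2 ^ n * ∑ j, (∑ j, lpNormS 1 (𝓕⁻ (ψ j)) + 1) * lpNormS p (D j) := by
        refine mul_le_mul_of_nonneg_left ?_ (by positivity)
        refine (lpNormS_sum_le _ _ hp).trans (Finset.sum_le_sum fun j _ => ?_)
        refine (lpNormS_multiplier_dilate_le a (ψ j) (D j) hp).trans
          (mul_le_mul_of_nonneg_right ?_ (hD j))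
        have := Finset.single_le_sum (fun j _ => hB j) (Finset.mem_univ j)
        linarith
    _ = _ := by
        rw [← Finset.mul_sum]
        ring

end Blocks

section ParaproductBlocks

variable (P : LPCutoff)

/-- The `l`-th term of the paraproduct as a Schwartz function. -/
def paraTerm (f g : 𝓢(E3, ℂ)) (l : ℕ) : 𝓢(E3, ℂ) :=
  schwartzMul (∑ n ∈ Finset.range (l + 1), lpBlockS P n f) (lpBlockS P (l + 2) g)

theorem paraproduct_eq_tsum (f g : 𝓢(E3, ℂ)) (x : E3) :
    paraproduct P f g x = ∑' l, paraTerm P f g l x := by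
  unfold paraproduct LPlow paraTerm
  refine tsum_congr fun l => ?_
  rw [schwartzMul_apply, sum_apply, LPblock_coe]
  simp only [LPblock_coe]

theorem summable_lpNormS_one_paraTerm (f g : 𝓢(E3, ℂ)) :
    Summable fun l => lpNormS 1 (paraTerm P f g l) := by
  obtain ⟨A, hA, hAb⟩ := exists_lpNormS_lpBlockS_le P
  obtain ⟨B, hB, hBb⟩ := exists_lpNormS_lpBlockS_le_gradient P
  have hD := fun j : Fin 3 => lpNormS_nonneg 1 (∂_{(EuclideanSpace.single j 1 : E3)} g)
  have hs : Summable fun l : ℕ => (l : ℝ) ^ 1 * (1 / 2 : ℝ) ^ l :=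
    summable_pow_mul_geometric_of_norm_lt_one 1 (by norm_num)
  have hs' : Summable fun l : ℕ => ((l + 1 : ℕ) : ℝ) ^ 1 * (1 / 2 : ℝ) ^ (l + 1) :=
    (summable_nat_add_iff 1).2 hs
  refine Summable.of_nonneg_of_le (fun l => lpNormS_nonneg _ _) (fun l => ?_)
    (hs'.mul_left (A * lpNormS ⊤ f *
      (B * ∑ j, A * lpNormS 1 (∂_{(EuclideanSpace.single j 1 : E3)} g))))
  have h1 : lpNormS ⊤ (∑ n ∈ Finset.range (l + 1), lpBlockS P n f) ≤
      ((l + 1 : ℕ) : ℝ) * (A * lpNormS ⊤ f) := by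
    refine (lpNormS_sum_le _ _ le_top).trans ?_
    refine (Finset.sum_le_sum fun n _ => hAb n ⊤ le_top f).trans ?_
    simp
  have h2 : lpNormS 1 (lpBlockS P (l + 2) g) ≤ (1 / 2 : ℝ) ^ (l + 1) *
      (B * ∑ j, A * lpNormS 1 (∂_{(EuclideanSpace.single j 1 : E3)} g)) := by
    refine (hBb (l + 2) (by omega) 1 le_rfl g).trans ?_
    have h3 : B / 2 ^ (l + 2) ≤ (1 / 2 : ℝ) ^ (l + 1) * B := by
      rw [div_eq_mul_one_div, mul_comm, ← one_div_pow]
      exact mul_le_mul_of_nonneg_right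
        (pow_le_pow_of_le_one (by norm_num) (by norm_num) (by omega)) hB.le
    rw [← mul_assoc]
    exact mul_le_mul h3 (Finset.sum_le_sum fun j _ => hAb _ _ le_rfl _)
      (Finset.sum_nonneg fun j _ => lpNormS_nonneg _ _) (by positivity)
  calc lpNormS 1 (paraTerm P f g l) ≤ _ := lpNormS_mul_le _ _ _
    _ ≤ _ := mul_le_mul h1 h2 (lpNormS_nonneg _ _)
      (mul_nonneg (by positivity) (mul_nonneg hA.le (lpNormS_nonneg _ _)))
    _ = _ := by ring

theorem integral_norm_eq_lpNormS_one (h : 𝓢(E3, ℂ)) : ∫ x, ‖h x‖ = lpNormS 1 h := by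
  rw [integral_norm_eq_lintegral_enorm h.continuous.aestronglyMeasurable, lpNormS,
    eLpNorm_one_eq_lintegral_enorm]

/-- The Fourier transform commutes with `L¹`-summable series of Schwartz functions. -/
theorem hasSum_fourier_tsum {u : ℕ → 𝓢(E3, ℂ)} (hu : Summable fun l => lpNormS 1 (u l))
    (ξ : E3) : HasSum (fun l => 𝓕 (u l) ξ) (𝓕 (fun x => ∑' l, u l x) ξ) := by
  have key := hasSum_integral_of_summable_integral_norm (μ := (volume : Measure E3))
    (F := fun l x => fourierChar (-inner ℝ x ξ) • u l x)
    (fun l => (Real.fourierIntegral_convergent_iff ξ).2 (u l).integrable) (by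
      simpa only [Circle.norm_smul, integral_norm_eq_lpNormS_one] using hu)
  have e : (fun x => ∑' l, fourierChar (-inner ℝ x ξ) • u l x) =
      fun x => fourierChar (-inner ℝ x ξ) • ∑' l, u l x := by
    ext x
    simp only [Circle.smul_def, smul_eq_mul, tsum_mul_left]
  rw [e] at key
  simp only [SchwartzMap.fourier_coe, Real.fourier_eq]
  exact key

theorem fourier_lpBlockS (n : ℕ) (h : 𝓢(E3, ℂ)) (ξ : E3) :
    𝓕 (lpBlockS P n h) ξ = lpSymbol P n ξ * 𝓕 h ξ :=
  fourier_schwartzMultiplier_apply _ _ _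

/-- The `l`-th term of the paraproduct lives at frequencies of size about `2^l`. -/
theorem lpSymbol_mul_fourier_paraTerm_eq_zero (f g : 𝓢(E3, ℂ)) {n l : ℕ}
    (h : l + 4 < n ∨ n + 3 < l) (ξ : E3) :
    lpSymbol P n ξ * 𝓕 (paraTerm P f g l) ξ = 0 := by
  by_cases h0 : lpSymbol P n ξ = 0
  · rw [h0, zero_mul]
  have hu := norm_le_of_lpSymbol_ne_zero P h0
  rw [paraTerm, fourier_schwartzMul_eq_zero, mul_zero]
  intro η
  by_contra! hc
  obtain ⟨h1, h2⟩ := hc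
  have hη : ‖η‖ ≤ 4 / 3 * 2 ^ l := by
    rw [FourierTransform.fourier_sum, sum_apply] at h1
    obtain ⟨m, hm, hm'⟩ := Finset.exists_ne_zero_of_sum_ne_zero h1
    rw [fourier_lpBlockS] at hm'
    have hm2 : m ≤ l := by simpa [Nat.lt_succ_iff] using hm
    refine (norm_le_of_lpSymbol_ne_zero P (left_ne_zero_of_mul hm')).trans ?_
    gcongr
    norm_num
  rw [fourier_lpBlockS] at h2
  have hl := le_norm_of_lpSymbol_ne_zero P (by omega) (left_ne_zero_of_mul h2)
  have hr := norm_le_of_lpSymbol_ne_zero P (left_ne_zero_of_mul h2)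
  have hpos : (0 : ℝ) < 2 ^ l := by positivity
  rw [pow_add] at hl hr
  have t1 : ‖ξ - η‖ ≤ ‖ξ‖ + ‖η‖ := norm_sub_le _ _
  have t2 : ‖ξ‖ ≤ ‖ξ - η‖ + ‖η‖ := by simpa using norm_add_le (ξ - η) η
  rcases h with h | h
  · have hn := le_norm_of_lpSymbol_ne_zero P (by omega) h0
    have : (2 : ℝ) ^ (l + 5) ≤ 2 ^ n := pow_le_pow_right₀ (by norm_num) (by omega)
    rw [pow_add] at this
    linarith
  · have : (2 : ℝ) ^ (n + 4) ≤ 2 ^ l := pow_le_pow_right₀ (by norm_num) (by omega)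
    rw [pow_add] at this
    linarith

/-- Only finitely many terms of the paraproduct contribute to a given frequency block. -/
theorem LPblock_paraproduct (f g : 𝓢(E3, ℂ)) (n : ℕ) :
    LPblock P n (paraproduct P f g) =
      ⇑(∑ l ∈ Finset.Icc (n - 4) (n + 3), lpBlockS P n (paraTerm P f g l)) := by
  have hT : paraproduct P f g = fun x => ∑' l, paraTerm P f g l x := by
    ext x
    exact paraproduct_eq_tsum P f g x
  have hS : ∑ l ∈ Finset.Icc (n - 4) (n + 3), lpBlockS P n (paraTerm P f g l) =
      lpBlockS P n (∑ l ∈ Finset.Icc (n - 4) (n + 3), paraTerm P f g l) := by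
    refine schwartz_ext_fourier fun ξ => ?_
    rw [fourier_lpBlockS, FourierTransform.fourier_sum, FourierTransform.fourier_sum, sum_apply,
      sum_apply, Finset.mul_sum]
    simp only [fourier_lpBlockS]
  rw [hS, LPblock_eq_fourierInv, lpBlockS, coe_schwartzMultiplier, hT]
  congr 1
  ext ξ
  have h1 := hasSum_fourier_tsum (summable_lpNormS_one_paraTerm P f g) ξ
  rw [← SchwartzMap.fourier_coe, FourierTransform.fourier_sum, sum_apply, Finset.mul_sum,
    ← h1.tsum_eq, ← tsum_mul_left]
  refine tsum_eq_sum fun l hl => lpSymbol_mul_fourier_paraTerm_eq_zero P f g ?_ ξ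
  simp only [Finset.mem_Icc, not_and_or, not_le] at hl
  omega

end ParaproductBlocks

section BesovBounds

variable (P : LPCutoff)

theorem toReal_eLpNorm_LPblock (n : ℕ) (p : ℝ≥0∞) (h : 𝓢(E3, ℂ)) :
    (eLpNorm (LPblock P n h) p volume).toReal = lpNormS p (lpBlockS P n h) := by
  rw [LPblock_coe, lpNormS]

theorem besov_top_ne_top {t : ℝ} (ht : t < 0) (f : 𝓢(E3, ℂ)) : besov P t ⊤ ⊤ f ≠ ⊤ := by
  obtain ⟨A, hA, hAb⟩ := exists_lpNormS_lpBlockS_le P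
  have hf := lpNormS_nonneg ⊤ f
  unfold besov besovW
  rw [eLpNorm_exponent_top]
  refine ((eLpNormEssSup_le_of_ae_bound (C := (2 : ℝ) ^ (-t) * (A * lpNormS ⊤ f))
    (Filter.Eventually.of_forall fun n => ?_)).trans_lt ENNReal.ofReal_lt_top).ne
  rw [toReal_eLpNorm_LPblock, one_mul, Real.norm_of_nonneg (mul_nonneg (by positivity)
    (lpNormS_nonneg _ _))]
  refine mul_le_mul (Real.rpow_le_rpow_of_exponent_le one_le_two ?_) (hAb n ⊤ le_top f)
    (lpNormS_nonneg _ _) (by positivity)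
  have : (0 : ℝ) ≤ n := by positivity
  nlinarith

theorem lpNormS_lpBlockS_le_besov {t : ℝ} (ht : t < 0) (f : 𝓢(E3, ℂ)) (n : ℕ) :
    lpNormS ⊤ (lpBlockS P n f) ≤ (2 : ℝ) ^ (-(((n : ℝ) - 1) * t)) * (besov P t ⊤ ⊤ f).toReal := by
  have hfin := besov_top_ne_top P ht f
  have h1 : ‖(1 : ℝ) * (2 : ℝ) ^ (((n : ℝ) - 1) * t) *
      (eLpNorm (LPblock P n f) ⊤ volume).toReal‖ₑ ≤ besov P t ⊤ ⊤ f := by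
    unfold besov besovW
    rw [eLpNorm_exponent_top]
    exact Measure.ae_count_iff.1 (ae_le_eLpNormEssSup (μ := (Measure.count : Measure ℕ))
      (f := fun n : ℕ => (1 : ℝ) * (2 : ℝ) ^ (((n : ℝ) - 1) * t) *
        (eLpNorm (LPblock P n f) ⊤ volume).toReal)) n
  have h2 := ENNReal.toReal_mono hfin h1
  rw [toReal_enorm, toReal_eLpNorm_LPblock, one_mul, Real.norm_of_nonneg
    (mul_nonneg (by positivity) (lpNormS_nonneg _ _))] at h2
  rw [Real.rpow_neg two_pos.le, ← div_eq_inv_mul, le_div_iff₀ (by positivity), mul_comm]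
  exact h2

/-- Low-frequency cutoffs in a Besov space of negative regularity. -/
theorem exists_lpNormS_low_le {t : ℝ} (ht : t < 0) :
    ∃ K : ℝ, 0 < K ∧ ∀ (f : 𝓢(E3, ℂ)) (l : ℕ),
      lpNormS ⊤ (∑ n ∈ Finset.range (l + 1), lpBlockS P n f) ≤
        K * (2 : ℝ) ^ (-(((l : ℝ) + 1) * t)) * (besov P t ⊤ ⊤ f).toReal := by
  set c : ℝ := (2 : ℝ) ^ (-t)
  have hc : 1 < c := Real.one_lt_rpow one_lt_two (by linarith)
  have hc0 : 0 < c := by linarith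
  have hcn : ∀ n : ℕ, (2 : ℝ) ^ (-((n : ℝ) * t)) = c ^ n := fun n => by
    rw [← Real.rpow_natCast, ← Real.rpow_mul two_pos.le]
    ring_nf
  have hcn' : ∀ n : ℕ, (2 : ℝ) ^ (-(((n : ℝ) - 1) * t)) = c⁻¹ * c ^ n := fun n => by
    rw [← hcn, ← Real.rpow_neg two_pos.le, ← Real.rpow_add two_pos]
    ring_nf
  refine ⟨c⁻¹ * (c - 1)⁻¹, mul_pos (inv_pos.2 hc0) (inv_pos.2 (by linarith)), fun f l => ?_⟩
  have hF : 0 ≤ (besov P t ⊤ ⊤ f).toReal := ENNReal.toReal_nonneg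
  refine (lpNormS_sum_le _ _ le_top).trans ?_
  refine (Finset.sum_le_sum fun n _ => lpNormS_lpBlockS_le_besov P ht f n).trans ?_
  rw [← Finset.sum_mul]
  refine mul_le_mul_of_nonneg_right ?_ hF
  have hl := hcn (l + 1)
  push_cast at hl
  simp only [hcn', hl]
  rw [← Finset.mul_sum, geom_sum_eq hc.ne', mul_assoc, ← div_eq_inv_mul (c ^ (l + 1))]
  have : 0 < c - 1 := by linarith
  gcongr
  linarith

theorem AFweight.monotone {δ : ℝ} {ω : ℕ → ℝ} (h : AFweight δ ω) : Monotone ω :=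
  monotone_nat_of_le_succ fun k => (h k).2.1

theorem AFweight.pos {δ : ℝ} {ω : ℕ → ℝ} (h : AFweight δ ω) (k : ℕ) : 0 < ω k :=
  one_pos.trans_le (h k).1

theorem AFweight.le_of_le_add_two {δ : ℝ} {ω : ℕ → ℝ} (h : AFweight δ ω) {n m : ℕ}
    (hnm : n ≤ m + 2) : ω n ≤ (2 : ℝ) ^ δ * (2 : ℝ) ^ δ * ω m := by
  refine (h.monotone hnm).trans ((h (m + 1)).2.2.trans ?_)
  rw [mul_assoc]
  exact mul_le_mul_of_nonneg_left (h m).2.2 (by positivity)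

/-- The terms of the weighted Besov norm of a gradient. -/
def gradBesovTerm (ω : ℕ → ℝ) (s : ℝ) (p : ℝ≥0∞) (g : E3 → ℂ) (n : ℕ) : ℝ :=
  ω n * (2 : ℝ) ^ (((n : ℝ) - 1) * s) *
    (∑ j : Fin 3, ((eLpNorm (LPblock P n (pdC j g)) p volume).toReal) ^ 2) ^ ((1 : ℝ) / 2)

theorem sum_le_two_mul_rpow_sum_sq (d : Fin 3 → ℝ) :
    ∑ j, d j ≤ 2 * (∑ j, d j ^ 2) ^ ((1 : ℝ) / 2) := by
  rw [← Real.sqrt_eq_rpow]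
  have h1 : (∑ j, d j) ^ 2 ≤ 3 * ∑ j, d j ^ 2 := by
    simpa using sq_sum_le_card_mul_sum_sq (s := Finset.univ) (f := d)
  have h2 : 0 ≤ ∑ j, d j ^ 2 := by positivity
  refine le_of_sq_le_sq ?_ (by positivity)
  rw [mul_pow, Real.sq_sqrt h2]
  linarith

/-- The contribution of one term of the paraproduct to one weighted frequency block. -/
theorem exists_weighted_block_paraTerm_le (δ s : ℝ) {t : ℝ} (ht : t < 0) {p : ℝ≥0∞} (hp : 1 ≤ p) :
    ∃ C : ℝ, 0 < C ∧ ∀ ω : ℕ → ℝ, AFweight δ ω → ∀ (f g : 𝓢(E3, ℂ)) (n l : ℕ),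
      n ≤ l + 4 → l ≤ n + 3 →
      ω n * (2 : ℝ) ^ (((n : ℝ) - 1) * s) * lpNormS p (lpBlockS P n (paraTerm P f g l)) ≤
        C * (besov P t ⊤ ⊤ f).toReal * gradBesovTerm P ω (s - t - 1) p g (l + 2) := by
  obtain ⟨A, hA, hAb⟩ := exists_lpNormS_lpBlockS_le P
  obtain ⟨B, hB, hBb⟩ := exists_lpNormS_lpBlockS_le_gradient P
  obtain ⟨K, hK, hKb⟩ := exists_lpNormS_low_le P ht
  refine ⟨(2 ^ δ * 2 ^ δ) * 2 ^ (5 * |s|) * (A * K * B * 2), by positivity,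
    fun ω hω f g n l hnl hln => ?_⟩
  set F := (besov P t ⊤ ⊤ f).toReal
  have hF : 0 ≤ F := ENNReal.toReal_nonneg
  set D := (∑ j : Fin 3,
    ((eLpNorm (LPblock P (l + 2) (pdC j g)) p volume).toReal) ^ 2) ^ ((1 : ℝ) / 2) with hD
  have hD0 : 0 ≤ D := by positivity
  have hg : lpNormS p (lpBlockS P (l + 2) g) ≤ B / 2 ^ (l + 2) * (2 * D) := by
    refine (hBb (l + 2) (by omega) p hp g).trans (mul_le_mul_of_nonneg_left ?_ (by positivity))
    simp only [hD, pdC_coe, toReal_eLpNorm_LPblock]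
    exact sum_le_two_mul_rpow_sum_sq _
  have hblock : lpNormS p (lpBlockS P n (paraTerm P f g l)) ≤
      A * ((K * (2 : ℝ) ^ (-(((l : ℝ) + 1) * t)) * F) * (B / 2 ^ (l + 2) * (2 * D))) := by
    refine (hAb n p hp _).trans (mul_le_mul_of_nonneg_left ?_ hA.le)
    exact (lpNormS_mul_le _ _ _).trans
      (mul_le_mul (hKb f l) hg (lpNormS_nonneg _ _) (by positivity))
  have hω' : ω n ≤ 2 ^ δ * 2 ^ δ * ω (l + 2) := hω.le_of_le_add_two (by omega)
  have hs : (2 : ℝ) ^ (((n : ℝ) - 1) * s) ≤ 2 ^ (5 * |s|) * 2 ^ (((l : ℝ) + 1) * s) := by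
    rw [← Real.rpow_add two_pos]
    refine Real.rpow_le_rpow_of_exponent_le one_le_two ?_
    have h1 : |((n : ℝ) - (l + 2)) * s| ≤ 5 * |s| := by
      rw [abs_mul]
      refine mul_le_mul_of_nonneg_right (abs_le.2 ⟨?_, ?_⟩) (abs_nonneg s)
      · have : (l : ℝ) ≤ n + 3 := by exact_mod_cast hln
        linarith
      · have : (n : ℝ) ≤ l + 4 := by exact_mod_cast hnl
        linarith
    have h2 := le_abs_self (((n : ℝ) - (l + 2)) * s)
    linarith
  have hωp := hω.pos (l + 2)
  have hpow : (1 : ℝ) / 2 ^ (l + 2) ≤ 2 ^ (-((l : ℝ) + 1)) := by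
    rw [Real.rpow_neg two_pos.le, one_div]
    refine inv_anti₀ (by positivity) ?_
    rw [← Real.rpow_natCast]
    refine Real.rpow_le_rpow_of_exponent_le one_le_two ?_
    push_cast
    linarith
  have hexp : (2 : ℝ) ^ ((((l + 2 : ℕ) : ℝ) - 1) * (s - t - 1)) =
      2 ^ (((l : ℝ) + 1) * s) * 2 ^ (-(((l : ℝ) + 1) * t)) * 2 ^ (-((l : ℝ) + 1)) := by
    rw [← Real.rpow_add two_pos, ← Real.rpow_add two_pos]
    push_cast
    ring_nf
  calc _ ≤ (2 ^ δ * 2 ^ δ * ω (l + 2)) * (2 ^ (5 * |s|) * 2 ^ (((l : ℝ) + 1) * s)) *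
        (A * ((K * (2 : ℝ) ^ (-(((l : ℝ) + 1) * t)) * F) * (B / 2 ^ (l + 2) * (2 * D)))) := by
        refine mul_le_mul (mul_le_mul hω' hs (by positivity) (by positivity)) hblock
          (lpNormS_nonneg _ _) (by positivity)
    _ = (2 ^ δ * 2 ^ δ * ω (l + 2)) * (2 ^ (5 * |s|) * 2 ^ (((l : ℝ) + 1) * s)) *
        (A * ((K * (2 : ℝ) ^ (-(((l : ℝ) + 1) * t)) * F) * (B * (2 * D)))) *
        (1 / 2 ^ (l + 2)) := by ring
    _ ≤ (2 ^ δ * 2 ^ δ * ω (l + 2)) * (2 ^ (5 * |s|) * 2 ^ (((l : ℝ) + 1) * s)) *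
        (A * ((K * (2 : ℝ) ^ (-(((l : ℝ) + 1) * t)) * F) * (B * (2 * D)))) *
        2 ^ (-((l : ℝ) + 1)) := mul_le_mul_of_nonneg_left hpow (by positivity)
    _ = _ := by
        rw [gradBesovTerm, ← hD, hexp]
        ring

theorem gradBesovTerm_nonneg {δ : ℝ} {ω : ℕ → ℝ} (hω : AFweight δ ω) (s : ℝ) (p : ℝ≥0∞)
    (g : E3 → ℂ) (n : ℕ) : 0 ≤ gradBesovTerm P ω s p g n := by
  have := hω.pos n
  unfold gradBesovTerm
  positivity

/-- Reindexing injectively a sequence does not increase its `ℓ^r` norm. -/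
theorem eLpNorm_count_indicator_comp_le {s : Set ℕ} {σ : ℕ → ℕ} (hσ : Set.InjOn σ s) (b : ℕ → ℝ)
    (r : ℝ≥0∞) :
    eLpNorm (s.indicator (b ∘ σ)) r Measure.count ≤ eLpNorm b r Measure.count := by
  have hs : MeasurableSet s := .of_discrete
  have hm : Measurable σ := measurable_from_nat
  rw [eLpNorm_indicator_eq_eLpNorm_restrict hs,
    ← eLpNorm_map_measure (StronglyMeasurable.of_discrete.aestronglyMeasurable) hm.aemeasurable]
  refine eLpNorm_mono_measure b (Measure.le_iff.2 fun u _ => ?_)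
  rw [Measure.map_apply hm .of_discrete, Measure.restrict_apply .of_discrete,
    Measure.count_apply .of_discrete, Measure.count_apply .of_discrete]
  refine ENat.toENNReal_le.2 (Set.encard_le_encard_of_injOn (f := σ) ?_
    (hσ.mono Set.inter_subset_right))
  exact fun x hx => hx.1

/-- The `n`-th weighted block of the paraproduct is bounded by eight shifted gradient terms. -/
theorem exists_weighted_block_paraproduct_le (δ s : ℝ) {t : ℝ} (ht : t < 0) {p : ℝ≥0∞}
    (hp : 1 ≤ p) :
    ∃ C : ℝ, 0 < C ∧ ∀ ω : ℕ → ℝ, AFweight δ ω → ∀ (f g : 𝓢(E3, ℂ)) (n : ℕ),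
      ω n * (2 : ℝ) ^ (((n : ℝ) - 1) * s) *
          (eLpNorm (LPblock P n (paraproduct P f g)) p volume).toReal ≤
        C * (besov P t ⊤ ⊤ f).toReal * ∑ i ∈ Finset.range 8, {m : ℕ | 4 ≤ m + i}.indicator
          (gradBesovTerm P ω (s - t - 1) p g ∘ fun m => m + i - 2) n := by
  obtain ⟨C, hC, hCb⟩ := exists_weighted_block_paraTerm_le P δ s ht hp
  refine ⟨C, hC, fun ω hω f g n => ?_⟩
  have hωp := hω.pos n
  set F := (besov P t ⊤ ⊤ f).toReal
  have hF : 0 ≤ F := ENNReal.toReal_nonneg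
  set b := gradBesovTerm P ω (s - t - 1) p g
  have hb : ∀ m, 0 ≤ b m := gradBesovTerm_nonneg P hω _ _ _
  have h1 : (eLpNorm (LPblock P n (paraproduct P f g)) p volume).toReal ≤
      ∑ l ∈ Finset.Icc (n - 4) (n + 3), lpNormS p (lpBlockS P n (paraTerm P f g l)) := by
    rw [LPblock_paraproduct]
    exact lpNormS_sum_le _ _ hp
  refine (mul_le_mul_of_nonneg_left h1 (by positivity)).trans ?_
  rw [Finset.mul_sum]
  refine (Finset.sum_le_sum (g := fun l => C * F * b (l + 2)) fun l hl => ?_).trans ?_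
  · rw [Finset.mem_Icc] at hl
    exact hCb ω hω f g n l (by omega) (by omega)
  rw [← Finset.mul_sum]
  refine mul_le_mul_of_nonneg_left ?_ (by positivity)
  have h2 : ∑ l ∈ Finset.Icc (n - 4) (n + 3), b (l + 2) =
      ∑ l ∈ Finset.Icc (n - 4) (n + 3), {m : ℕ | 4 ≤ m + (l + 4 - n)}.indicator
          (b ∘ fun m => m + (l + 4 - n) - 2) n := by
    refine Finset.sum_congr rfl fun l hl => ?_
    rw [Finset.mem_Icc] at hl
    rw [Set.indicator_of_mem (by rw [Set.mem_ofPred_eq]; omega), Function.comp_apply]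
    congr 1
    omega
  have hinj : Set.InjOn (fun l => l + 4 - n) (Finset.Icc (n - 4) (n + 3) : Set ℕ) := by
    intro x hx y hy hxy
    simp only [Finset.coe_Icc, Set.mem_Icc] at hx hy hxy
    omega
  rw [h2, ← Finset.sum_image (g := fun l => l + 4 - n) (f := fun i =>
    {m : ℕ | 4 ≤ m + i}.indicator (b ∘ fun m => m + i - 2) n) hinj]
  refine Finset.sum_le_sum_of_subset_of_nonneg (fun i hi => ?_)
    fun i _ _ => Set.indicator_nonneg (fun m _ => hb _) n
  obtain ⟨l, hl, rfl⟩ := Finset.mem_image.1 hi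
  rw [Finset.mem_Icc] at hl
  rw [Finset.mem_range]
  omega

end BesovBounds

/-- Lemma 2.5, second inequality:
`∥T_f g∥_{B^s_{p,r}(ω)} ≤ C ∥f∥_{B^t_{∞,∞}} ∥∇g∥_{B^{s-t-1}_{p,r}(ω)}` for `t < 0`,
with `C` independent of the weight `ω ∈ AF(δ)`. -/
theorem paraproduct_weighted_negative (δ s t : ℝ) (hδ : 0 < δ) (ht : t < 0)
    (p r : ℝ≥0∞) (hp : 1 ≤ p) (hr : 1 ≤ r) (P : LPCutoff) :
    ∃ C : ℝ, 0 < C ∧ ∀ ω : ℕ → ℝ, AFweight δ ω → ∀ f g : SchwartzMap E3 ℂ,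
      besovW P ω s p r (paraproduct P ⇑f ⇑g) ≤
        ENNReal.ofReal C * besov P t ⊤ ⊤ ⇑f * gradBesovW P ω (s - t - 1) p r ⇑g := by
  obtain ⟨C, hC, hCb⟩ := exists_weighted_block_paraproduct_le P δ s ht hp
  refine ⟨C * 8, by positivity, fun ω hω f g => ?_⟩
  set F := (besov P t ⊤ ⊤ f).toReal with hFdef
  have hF : 0 ≤ F := ENNReal.toReal_nonneg
  set b := gradBesovTerm P ω (s - t - 1) p g with hb
  let v : ℕ → ℕ → ℝ := fun i => {m : ℕ | 4 ≤ m + i}.indicator (b ∘ fun m => m + i - 2)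
  have hv : ∀ i, eLpNorm (v i) r Measure.count ≤ eLpNorm b r Measure.count := fun i => by
    refine eLpNorm_count_indicator_comp_le (fun x hx y hy hxy => ?_) b r
    simp only [Set.mem_ofPred_eq] at hx hy hxy
    omega
  have h1 : besovW P ω s p r (paraproduct P f g) ≤
      eLpNorm ((C * F) • ∑ i ∈ Finset.range 8, v i) r Measure.count := by
    refine eLpNorm_mono_real fun n => ?_
    have := hω.pos n
    rw [Real.norm_of_nonneg (mul_nonneg (by positivity) ENNReal.toReal_nonneg), Pi.smul_apply,
      Finset.sum_apply, smul_eq_mul]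
    exact hCb ω hω f g n
  have h2 : eLpNorm (∑ i ∈ Finset.range 8, v i) r Measure.count ≤
      8 * eLpNorm b r Measure.count := by
    refine (eLpNorm_sum_le (fun i _ => StronglyMeasurable.of_discrete.aestronglyMeasurable)
      hr).trans ((Finset.sum_le_sum fun i _ => hv i).trans ?_)
    simp
  refine h1.trans ?_
  rw [eLpNorm_const_smul, Real.enorm_of_nonneg (by positivity), ENNReal.ofReal_mul hC.le, hFdef,
    ENNReal.ofReal_toReal (besov_top_ne_top P ht f), ENNReal.ofReal_mul hC.le]
  refine (mul_le_mul_right h2 _).trans (le_of_eq ?_)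
  rw [show gradBesovW P ω (s - t - 1) p r g = eLpNorm b r Measure.count from rfl,
    ENNReal.ofReal_ofNat]
  ring

end
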